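/- arXiv:1503.02346 — 2 statements merged into one kernel-verified Lean document; each statement's English description precedes it below -/
import Mathlib

section
/- For every real b > 0 and every real t ≥ 0, ∫_0^∞ [(1+e^{−bw})^t + (1−e^{−bw})^t] e^{−w} dw = 2 + 2∑_{n even, n≥2} C(t,n)/(nb+1), where C(t,n) = (∏_{l=0}^{n−1}(t−l))/n! and the sum is over even integers n ≥ 2; the integrand is integrable on (0,∞) and the series converges. -/
open MeasureTheory Real

/-- The generalized binomial coefficient `C(t,n) = (∏_{l=0}^{n−1}(t−l))/n!`. -/
noncomputable def genC (t : ℝ) (n : ℕ) : ℝ :=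
  (∏ l ∈ Finset.range n, (t - l)) / (n.factorial : ℝ)

theorem genC_eq_choose (t : ℝ) (n : ℕ) : genC t n = Ring.choose t n := by
  have h := Ring.descPochhammer_eq_factorial_smul_choose t n
  rw [← Polynomial.aeval_eq_smeval, Polynomial.aeval_def, ← Polynomial.eval_map,
    descPochhammer_map, descPochhammer_eval_eq_prod_range, nsmul_eq_mul] at h
  rw [genC, h, mul_div_cancel_left₀ _ (by positivity)]

theorem genC_zero_right (t : ℝ) : genC t 0 = 1 := by
  simp [genC]

theorem genC_succ_mul (t : ℝ) (n : ℕ) : genC t (n + 1) * (n + 1) = genC t n * (t - n) := by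
  rw [genC, genC, Finset.prod_range_succ, Nat.factorial_succ]
  push_cast
  field_simp

theorem hasSum_genC_mul_pow (t : ℝ) {x : ℝ} (hx : |x| < 1) :
    HasSum (fun n : ℕ => genC t n * x ^ n) ((1 + x) ^ t) := by
  have h := (Real.one_add_rpow_hasFPowerSeriesOnBall_zero (a := t)).hasSum (y := x)
    (by simpa [enorm_eq_nnnorm, ← NNReal.coe_lt_coe] using hx)
  simp only [binomialSeries_apply, List.ofFn_const, List.prod_replicate, smul_eq_mul,
    zero_add] at h
  simpa only [genC_eq_choose] using h

/-- Beyond `t` the quantities `n |C(t,n)|` decrease, with successive differences `t |C(t,n)|`. -/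
theorem summable_abs_genC {t : ℝ} (ht : 0 ≤ t) : Summable (fun n : ℕ => |genC t n|) := by
  rcases ht.eq_or_lt with rfl | ht
  · refine summable_of_ne_finset_zero (s := {0}) fun n hn => ?_
    obtain ⟨k, rfl⟩ := Nat.exists_eq_succ_of_ne_zero (by simpa using hn)
    simp [genC, Finset.prod_range_succ']
  obtain ⟨N, hN⟩ := exists_nat_ge t
  rw [← summable_nat_add_iff N]
  refine summable_of_sum_range_le (c := N * |genC t N| / t) (fun _ => abs_nonneg _) fun K => ?_
  have hstep (k : ℕ) : t * |genC t (k + N)| =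
      ((k + N : ℕ) : ℝ) * |genC t (k + N)|
        - ((k + 1 + N : ℕ) : ℝ) * |genC t (k + 1 + N)| := by
    have h := congrArg abs (genC_succ_mul t (k + N))
    have hk : t - ((k + N : ℕ) : ℝ) ≤ 0 := by
      push_cast
      linarith [Nat.cast_nonneg (α := ℝ) k]
    rw [abs_mul, abs_mul, abs_of_nonpos hk,
      abs_of_nonneg (show (0 : ℝ) ≤ ((k + N : ℕ) : ℝ) + 1 by positivity)] at h
    rw [show k + 1 + N = k + N + 1 by ring]
    push_cast at h ⊢
    linarith
  rw [le_div_iff₀ ht, mul_comm, Finset.mul_sum, Finset.sum_congr rfl fun k _ => hstep k,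
    Finset.sum_range_sub' (fun k : ℕ => ((k + N : ℕ) : ℝ) * |genC t (k + N)|)]
  have : 0 ≤ ((K + N : ℕ) : ℝ) * |genC t (K + N)| := by positivity
  simpa using this

theorem hasSum_even_genC_mul_pow (t : ℝ) {x : ℝ} (hx : |x| < 1) :
    HasSum (fun m : ℕ => 2 * genC t (2 * m) * x ^ (2 * m)) ((1 + x) ^ t + (1 - x) ^ t) := by
  have h := (hasSum_genC_mul_pow t hx).add
    (hasSum_genC_mul_pow t (x := -x) (by rwa [abs_neg]))
  rw [← sub_eq_add_neg] at h
  have hinj : Function.Injective fun m : ℕ => 2 * m := mul_right_injective₀ two_ne_zero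
  rw [← hinj.hasSum_iff] at h
  · convert h using 2 with m
    simp only [Function.comp_apply, (even_two_mul m).neg_pow]
    ring
  · intro n hn
    have hodd : Odd n := by
      rw [← Nat.not_even_iff_odd]
      rintro ⟨k, rfl⟩
      exact hn ⟨k, by simp only; ring⟩
    rw [hodd.neg_pow]
    ring

theorem summable_even_genC_div {b t : ℝ} (hb : 0 < b) (ht : 0 ≤ t) :
    Summable (fun m : ℕ => |2 * genC t (2 * m)| / ((2 * m : ℕ) * b + 1)) := by
  have hinj : Function.Injective fun m : ℕ => 2 * m := mul_right_injective₀ two_ne_zero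
  refine (((summable_abs_genC ht).comp_injective hinj).mul_left 2).of_nonneg_of_le
    (fun m => by positivity) fun m => ?_
  rw [abs_mul, abs_two]
  have : 0 ≤ ((2 * m : ℕ) : ℝ) * b := by positivity
  exact div_le_self (by positivity) (le_add_of_nonneg_left this)

theorem integrableOn_rpow_exp {b t : ℝ} (hb : 0 < b) (ht : 0 ≤ t) :
    IntegrableOn
      (fun w : ℝ => ((1 + Real.exp (-b * w)) ^ t + (1 - Real.exp (-b * w)) ^ t)
        * Real.exp (-w)) (Set.Ioi 0) volume := by
  have hexp : IntegrableOn (fun w : ℝ => Real.exp (-w)) (Set.Ioi 0) := by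
    simpa using exp_neg_integrableOn_Ioi 0 one_pos
  refine Integrable.bdd_mul (c := 2 ^ t + 1) hexp (by fun_prop) ?_
  filter_upwards [ae_restrict_mem measurableSet_Ioi] with w hw
  have hle : Real.exp (-b * w) ≤ 1 := Real.exp_le_one_iff.2 (by nlinarith [Set.mem_Ioi.1 hw])
  have hpos := Real.exp_pos (-b * w)
  have h₁ : (0 : ℝ) ≤ 1 - Real.exp (-b * w) := by linarith
  rw [Real.norm_of_nonneg (by positivity)]
  gcongr
  · linarith
  · exact Real.rpow_le_one h₁ (by linarith) ht

theorem hasSum_integral_rpow_exp {b t : ℝ} (hb : 0 < b) (ht : 0 ≤ t) :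
    HasSum (fun m : ℕ => 2 * genC t (2 * m) / ((2 * m : ℕ) * b + 1))
      (∫ w in Set.Ioi (0 : ℝ),
        ((1 + Real.exp (-b * w)) ^ t + (1 - Real.exp (-b * w)) ^ t) * Real.exp (-w)) := by
  have hneg (m : ℕ) : -((2 * m : ℕ) * b + 1) < 0 := neg_neg_of_pos (by positivity)
  have hint (m : ℕ) : ∫ w in Set.Ioi (0 : ℝ), Real.exp (-((2 * m : ℕ) * b + 1) * w)
      = 1 / ((2 * m : ℕ) * b + 1) := by
    rw [integral_exp_mul_Ioi (hneg m), mul_zero, Real.exp_zero, neg_div_neg_eq]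
  have hsum (w : ℝ) (hw : w ∈ Set.Ioi (0 : ℝ)) :
      HasSum (fun m : ℕ => 2 * genC t (2 * m) * Real.exp (-((2 * m : ℕ) * b + 1) * w))
        (((1 + Real.exp (-b * w)) ^ t + (1 - Real.exp (-b * w)) ^ t) * Real.exp (-w)) := by
    have hx : |Real.exp (-b * w)| < 1 := by
      rw [Real.abs_exp, Real.exp_lt_one_iff]
      nlinarith [Set.mem_Ioi.1 hw]
    refine ((hasSum_even_genC_mul_pow t hx).mul_right (Real.exp (-w))).congr_fun fun m => ?_
    rw [← Real.exp_nat_mul, mul_assoc (2 * genC t (2 * m)), ← Real.exp_add]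
    ring_nf
  have key := hasSum_integral_of_summable_integral_norm
    (F := fun (m : ℕ) (w : ℝ) => 2 * genC t (2 * m) * Real.exp (-((2 * m : ℕ) * b + 1) * w))
    (μ := volume.restrict (Set.Ioi (0 : ℝ)))
    (fun m => (integrableOn_exp_mul_Ioi (hneg m) 0).const_mul _) ?_
  · rw [setIntegral_congr_fun measurableSet_Ioi fun w hw => (hsum w hw).tsum_eq] at key
    simpa only [integral_const_mul, hint, mul_one_div] using key
  · simp only [norm_mul _ (Real.exp _), Real.norm_eq_abs, Real.abs_exp, integral_const_mul,
      hint, mul_one_div]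
    exact summable_even_genC_div hb ht

/-- For `b > 0` and `t ≥ 0`,
`∫_0^∞ [(1+e^{−bw})^t + (1−e^{−bw})^t] e^{−w} dw = 2 + 2 ∑_{n even, n≥2} C(t,n)/(nb+1)`,
the integrand being integrable on `(0,∞)` and the series (indexed by `m ↦ n = 2(m+1)`)
being convergent. -/
theorem integral_exp_sum_eq_two_add_even_tsum (b t : ℝ) (hb : 0 < b) (ht : 0 ≤ t) :
    IntegrableOn
      (fun w : ℝ => ((1 + Real.exp (-b * w)) ^ t + (1 - Real.exp (-b * w)) ^ t)
        * Real.exp (-w)) (Set.Ioi 0) volume ∧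
    Summable (fun m : ℕ => genC t (2 * (m + 1)) / ((2 * (m + 1) : ℕ) * b + 1)) ∧
    ∫ w in Set.Ioi (0:ℝ),
        ((1 + Real.exp (-b * w)) ^ t + (1 - Real.exp (-b * w)) ^ t) * Real.exp (-w)
      = 2 + 2 * ∑' m : ℕ, genC t (2 * (m + 1)) / ((2 * (m + 1) : ℕ) * b + 1) := by
  have h := hasSum_integral_rpow_exp hb ht
  have hs : Summable fun m : ℕ => genC t (2 * (m + 1)) / ((2 * (m + 1) : ℕ) * b + 1) := by
    have := ((summable_nat_add_iff 1).2 h.summable).mul_left (1 / 2)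
    refine this.congr fun m => ?_
    ring
  refine ⟨integrableOn_rpow_exp hb ht, hs, ?_⟩
  rw [← h.tsum_eq, h.summable.tsum_eq_zero_add, ← tsum_mul_left]
  simp [genC_zero_right, mul_div_assoc]
end

section
/- For every real b > 0 and every real t with 0 ≤ t < 1, the function u ↦ (1+u^b)^{−t} is integrable on (0,1) and ∫_0^1 (1+u^b)^{−t} du = ∑_{n=0}^∞ (−1)^n D(t,n)/(nb+1), where D(t,n) = (∏_{l=0}^{n−1}(t+l))/n! and the series converges. -/
open MeasureTheory

/-- `D(t,n) = (∏_{l=0}^{n−1}(t+l))/n!`, so that `(−1)^n D(t,n)` is the generalized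
binomial coefficient `C(−t,n)`. -/
noncomputable def genD (t : ℝ) (n : ℕ) : ℝ :=
  (∏ l ∈ Finset.range n, (t + l)) / (n.factorial : ℝ)

theorem genD_nonneg {t : ℝ} (ht : 0 ≤ t) (n : ℕ) : 0 ≤ genD t n := by
  unfold genD
  have : 0 ≤ ∏ l ∈ Finset.range n, (t + l) := Finset.prod_nonneg fun l _ => by positivity
  positivity

theorem genD_zero (t : ℝ) : genD t 0 = 1 := by
  simp [genD]

theorem genD_succ (t : ℝ) (n : ℕ) : genD t (n + 1) = genD t n * (t + n) / (n + 1) := by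
  unfold genD
  rw [Finset.prod_range_succ, Nat.factorial_succ]
  push_cast
  field_simp

theorem genD_eq_multichoose (t : ℝ) (n : ℕ) : genD t n = Ring.multichoose t n := by
  have hprod : ∏ l ∈ Finset.range n, (t + l) = (ascPochhammer ℝ n).eval t := by
    induction n with
    | zero => simp
    | succ n ih => rw [Finset.prod_range_succ, ih, ascPochhammer_succ_eval]
  have h := Ring.factorial_nsmul_multichoose_eq_ascPochhammer t n
  rw [Polynomial.ascPochhammer_smeval_eq_eval, ← hprod, nsmul_eq_mul] at h
  rw [genD, ← h]
  field_simp

/-- The coefficients satisfy `(1 - t) * D(t,n) / (n + 1) = D(t,n) - D(t,n+1)`, so that the partial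
sums telescope. -/
theorem summable_genD_div_add_one {t : ℝ} (ht0 : 0 ≤ t) (ht1 : t < 1) :
    Summable fun n : ℕ => genD t n / (n + 1) := by
  have h1t : 0 < 1 - t := sub_pos.2 ht1
  have hsum (n : ℕ) :
      ∑ i ∈ Finset.range n, genD t i / (i + 1) = (1 - genD t n) / (1 - t) := by
    induction n with
    | zero => simp [genD_zero]
    | succ n ih =>
      rw [Finset.sum_range_succ, ih, genD_succ]
      field_simp
      ring
  refine summable_of_sum_range_le (c := 1 / (1 - t))
    (fun n => div_nonneg (genD_nonneg ht0 n) (by positivity)) fun n => ?_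
  rw [hsum]
  gcongr
  linarith [genD_nonneg ht0 n]

theorem summable_genD_div {b t : ℝ} (hb : 0 < b) (ht0 : 0 ≤ t) (ht1 : t < 1) :
    Summable fun n : ℕ => genD t n / (n * b + 1) := by
  refine Summable.of_nonneg_of_le (fun n => div_nonneg (genD_nonneg ht0 n) (by positivity))
    (fun n => ?_) ((summable_genD_div_add_one ht0 ht1).mul_left (1 + 1 / b))
  have hn : 1 / (n * b + 1) ≤ (1 + 1 / b) / (n + 1) := by
    rw [div_le_div_iff₀ (by positivity) (by positivity)]
    have : (1 + 1 / b) * (n * b + 1) = n * b + 1 + n + 1 / b := by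
      field_simp
      ring
    have : 0 ≤ n * b := by positivity
    have : 0 < 1 / b := by positivity
    linarith
  calc genD t n / (n * b + 1) = genD t n * (1 / (n * b + 1)) := by ring
    _ ≤ genD t n * ((1 + 1 / b) / (n + 1)) := mul_le_mul_of_nonneg_left hn (genD_nonneg ht0 n)
    _ = (1 + 1 / b) * (genD t n / (n + 1)) := by ring

theorem hasSum_genD_mul_pow (t : ℝ) {x : ℝ} (hx0 : 0 ≤ x) (hx1 : x < 1) :
    HasSum (fun n : ℕ => (-1) ^ n * genD t n * x ^ n) ((1 + x) ^ (-t)) := by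
  have hmem : -x ∈ Metric.eball (0 : ℝ) 1 := by
    rw [← ENNReal.ofReal_one, Metric.eball_ofReal, mem_ball_zero_iff, norm_neg, Real.norm_eq_abs,
      abs_of_nonneg hx0]
    exact hx1
  have h := (Real.one_div_one_sub_rpow_hasFPowerSeriesOnBall_zero t).hasSum hmem
  convert! h using 1
  · ext n
    simp only [FormalMultilinearSeries.ofScalars_apply_eq, Ring.choose, smul_eq_mul,
      genD_eq_multichoose]
    rw [neg_pow]
    ring_nf
  · rw [zero_add, sub_neg_eq_add, Real.rpow_neg (by positivity), one_div]

theorem integrableOn_rpow_Ioo_zero_one {r : ℝ} (hr : 0 ≤ r) :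
    IntegrableOn (fun u : ℝ => u ^ r) (Set.Ioo 0 1) :=
  ((Real.continuous_rpow_const hr).integrableOn_Icc).mono_set Set.Ioo_subset_Icc_self

theorem setIntegral_rpow_Ioo_zero_one {r : ℝ} (hr : 0 ≤ r) :
    ∫ u in Set.Ioo (0 : ℝ) 1, u ^ r = 1 / (r + 1) := by
  rw [← integral_Ioc_eq_integral_Ioo, ← intervalIntegral.integral_of_le zero_le_one,
    integral_rpow (Or.inl (by linarith)), Real.one_rpow, Real.zero_rpow (by linarith), sub_zero]

/-- For `b > 0` and `0 ≤ t < 1`, `u ↦ (1+u^b)^{−t}` is integrable on `(0,1)`,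
the series `∑ₙ (−1)^n D(t,n)/(nb+1)` converges, and
`∫_0^1 (1+u^b)^{−t} du = ∑_{n=0}^∞ (−1)^n D(t,n)/(nb+1)`. -/
theorem integral_one_add_rpow_neg_eq_tsum (b t : ℝ) (hb : 0 < b) (ht0 : 0 ≤ t) (ht1 : t < 1) :
    IntegrableOn (fun u : ℝ => (1 + u ^ b) ^ (-t)) (Set.Ioo 0 1) volume ∧
    Summable (fun n : ℕ => (-1 : ℝ) ^ n * genD t n / (n * b + 1)) ∧
    ∫ u in Set.Ioo (0:ℝ) 1, (1 + u ^ b) ^ (-t)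
      = ∑' n : ℕ, (-1 : ℝ) ^ n * genD t n / (n * b + 1) := by
  have hnb (n : ℕ) : 0 ≤ n * b := by positivity
  set F : ℕ → ℝ → ℝ := fun n u => (-1) ^ n * genD t n * u ^ (n * b) with hF
  have hF_int (n : ℕ) : Integrable (F n) (volume.restrict (Set.Ioo 0 1)) :=
    (integrableOn_rpow_Ioo_zero_one (hnb n)).const_mul _
  have hF_val (n : ℕ) :
      ∫ u in Set.Ioo (0 : ℝ) 1, F n u = (-1) ^ n * genD t n / (n * b + 1) := by
    rw [hF, integral_const_mul, setIntegral_rpow_Ioo_zero_one (hnb n), mul_one_div]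
  have hF_norm (n : ℕ) :
      ∫ u in Set.Ioo (0 : ℝ) 1, ‖F n u‖ = genD t n / (n * b + 1) := by
    rw [← mul_one_div, ← setIntegral_rpow_Ioo_zero_one (hnb n), ← integral_const_mul]
    refine setIntegral_congr_fun measurableSet_Ioo fun u hu => ?_
    simp [hF, abs_of_nonneg (genD_nonneg ht0 n), abs_of_nonneg (Real.rpow_nonneg hu.1.le _)]
  have hsum := hasSum_integral_of_summable_integral_norm hF_int
    (by simpa only [hF_norm] using summable_genD_div hb ht0 ht1)
  have hF_tsum : ∀ u ∈ Set.Ioo (0 : ℝ) 1, ∑' n, F n u = (1 + u ^ b) ^ (-t) := fun u hu => by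
    rw [← (hasSum_genD_mul_pow t (Real.rpow_nonneg hu.1.le b)
      (Real.rpow_lt_one hu.1.le hu.2 hb)).tsum_eq]
    refine tsum_congr fun n => ?_
    simp only [hF]
    rw [mul_comm (n : ℝ) b, Real.rpow_mul_natCast hu.1.le]
  simp only [hF_val] at hsum
  rw [setIntegral_congr_fun measurableSet_Ioo hF_tsum] at hsum
  refine ⟨?_, hsum.summable, hsum.tsum_eq.symm⟩
  refine IntegrableOn.mono_set (t := Set.Icc 0 1) ?_ Set.Ioo_subset_Icc_self
  refine ContinuousOn.integrableOn_Icc fun u hu => ContinuousAt.continuousWithinAt ?_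
  have hpos : 0 < 1 + u ^ b := by linarith [Real.rpow_nonneg hu.1 b]
  exact (continuousAt_const.add (Real.continuousAt_rpow_const _ _ (Or.inr hb.le))).rpow_const
    (Or.inl hpos.ne')
end
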